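/- arXiv:2312.06605 — 5 statements merged into one kernel-verified Lean document; each statement's English description precedes it below -/
import Mathlib

section
/- Quadratic form identity and negative semidefiniteness of the leading Hessian block matrix: let n ≥ 2, r ≥ 1, let h_1,…,h_n ∈ ℝ^{r+1}, and let c_ij = c_ji ∈ ℝ for 1 ≤ i ≠ j ≤ n. Define the n(r+1) × n(r+1) block matrix H_L by its (r+1)×(r+1) blocks: [H_L]_{ii} = Σ_{j≠i} c_ij h_j h_jᵀ for each i, and [H_L]_{ij} = c_ij h_j h_iᵀ for i ≠ j. Then for every u ∈ ℝ^{n(r+1)} with node blocks u_1,…,u_n ∈ ℝ^{r+1}: uᵀ H_L u = Σ_{1≤i<j≤n} c_ij (h_jᵀ u_i + h_iᵀ u_j)². In particular, if c_ij ≤ 0 for all i ≠ j then H_L is negative semidefinite, and if c_ij < 0 for all i ≠ j then uᵀ H_L u = 0 if and only if h_jᵀ u_i + h_iᵀ u_j = 0 for all i < j. -/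
open scoped BigOperators Matrix

noncomputable section

/-- the leading Hessian block matrix `H_L`: diagonal blocks `Σ_{j≠i} c_ij h_j h_jᵀ`,
off-diagonal blocks `c_ij h_j h_iᵀ`. -/
def HLmat (n r : ℕ) (h : Fin n → Fin (r + 1) → ℝ) (c : Fin n → Fin n → ℝ) :
    Matrix (Fin n × Fin (r + 1)) (Fin n × Fin (r + 1)) ℝ :=
  Matrix.of fun p q =>
    if p.1 = q.1 then
      ∑ j ∈ Finset.univ.filter (· ≠ p.1), c p.1 j * h j p.2 * h j q.2
    else c p.1 q.1 * h q.1 p.2 * h p.1 q.2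

theorem sum_sum_ne_eq_sum_lt {ι M : Type*} [Fintype ι] [LinearOrder ι] [AddCommMonoid M]
    (F : ι → ι → M) :
    ∑ i, ∑ j ∈ Finset.univ.filter (· ≠ i), F i j
      = ∑ p ∈ Finset.univ.filter (fun p : ι × ι => p.1 < p.2), (F p.1 p.2 + F p.2 p.1) := by
  have hswap : ∑ i, ∑ j, (if i < j then F j i else 0) = ∑ i, ∑ j, if j < i then F i j else 0 :=
    Finset.sum_comm
  simp only [Finset.sum_filter, Fintype.sum_prod_type, Finset.sum_add_distrib]
  rw [hswap, ← Finset.sum_add_distrib]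
  refine Finset.sum_congr rfl fun i _ => ?_
  rw [← Finset.sum_add_distrib]
  refine Finset.sum_congr rfl fun j _ => ?_
  rcases lt_trichotomy i j with hij | rfl | hij
  · simp [hij, hij.ne', hij.not_gt]
  · simp
  · simp [hij, hij.ne, hij.not_gt]

theorem HLmat_block_bilinear (n r : ℕ) (h : Fin n → Fin (r + 1) → ℝ) (c : Fin n → Fin n → ℝ)
    (u : Fin n → Fin (r + 1) → ℝ) (i j : Fin n) :
    ∑ k, ∑ l, u i k * (HLmat n r h c (i, k) (j, l) * u j l)
      = if i = j then ∑ m ∈ Finset.univ.filter (· ≠ i), c i m * (∑ k, h m k * u i k) ^ 2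
        else c i j * (∑ k, h j k * u i k) * ∑ k, h i k * u j k := by
  by_cases hij : i = j
  · subst hij
    simp only [HLmat, Matrix.of_apply, if_true, sq, Finset.sum_mul_sum]
    simp only [Finset.mul_sum, Finset.sum_mul]
    rw [Finset.sum_comm (s := Finset.univ.filter (· ≠ i))]
    refine Finset.sum_congr rfl fun k _ => ?_
    rw [Finset.sum_comm (s := Finset.univ.filter (· ≠ i))]
    refine Finset.sum_congr rfl fun l _ => Finset.sum_congr rfl fun m _ => ?_
    ring
  · simp only [HLmat, Matrix.of_apply, if_neg hij]
    rw [mul_assoc, Finset.sum_mul_sum]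
    simp only [Finset.mul_sum]
    refine Finset.sum_congr rfl fun k _ => Finset.sum_congr rfl fun l _ => ?_
    ring

theorem HLmat_quadratic_form_eq (n r : ℕ) (h : Fin n → Fin (r + 1) → ℝ)
    (c : Fin n → Fin n → ℝ) (hsymm : ∀ i j, c i j = c j i) (u : Fin n → Fin (r + 1) → ℝ) :
    (fun p : Fin n × Fin (r + 1) => u p.1 p.2) ⬝ᵥ
        (HLmat n r h c).mulVec (fun p => u p.1 p.2)
      = ∑ p ∈ Finset.univ.filter (fun p : Fin n × Fin n => p.1 < p.2),
          c p.1 p.2 * ((∑ k, h p.2 k * u p.1 k) + ∑ k, h p.1 k * u p.2 k) ^ 2 := by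
  have hblocks : (fun p : Fin n × Fin (r + 1) => u p.1 p.2) ⬝ᵥ
        (HLmat n r h c).mulVec (fun p => u p.1 p.2)
      = ∑ i, ∑ j, ∑ k, ∑ l, u i k * (HLmat n r h c (i, k) (j, l) * u j l) := by
    simp only [dotProduct, Matrix.mulVec, Fintype.sum_prod_type, Finset.mul_sum]
    exact Finset.sum_congr rfl fun i _ => Finset.sum_comm
  have hrow : ∀ i, ∑ j, ∑ k, ∑ l, u i k * (HLmat n r h c (i, k) (j, l) * u j l)
      = ∑ j ∈ Finset.univ.filter (· ≠ i), (c i j * (∑ k, h j k * u i k) ^ 2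
          + c i j * (∑ k, h j k * u i k) * ∑ k, h i k * u j k) := by
    intro i
    simp only [HLmat_block_bilinear]
    rw [Finset.sum_add_distrib, Finset.filter_ne', ← Finset.add_sum_erase _ _ (Finset.mem_univ i),
      if_pos rfl]
    congr 1
    exact Finset.sum_congr rfl fun j hj => if_neg (Finset.ne_of_mem_erase hj).symm
  rw [hblocks, Finset.sum_congr rfl fun i _ => hrow i, sum_sum_ne_eq_sum_lt]
  refine Finset.sum_congr rfl fun p _ => ?_
  rw [hsymm p.2 p.1]
  ring

theorem HLmat_isSymm (n r : ℕ) (h : Fin n → Fin (r + 1) → ℝ) (c : Fin n → Fin n → ℝ)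
    (hsymm : ∀ i j, c i j = c j i) : (HLmat n r h c).IsSymm := by
  refine Matrix.IsSymm.ext fun p q => ?_
  obtain ⟨i, k⟩ := p
  obtain ⟨j, l⟩ := q
  by_cases hij : i = j
  · subst hij
    simp only [HLmat, Matrix.of_apply, if_true]
    exact Finset.sum_congr rfl fun m _ => by ring
  · simp only [HLmat, Matrix.of_apply, if_neg hij, if_neg (Ne.symm hij), hsymm j i]
    ring

/-- **Quadratic form identity and negative semidefiniteness of the leading Hessian block
matrix.** For every `u` with node blocks `u_1, …, u_n`,
`uᵀ H_L u = Σ_{i<j} c_ij (h_jᵀu_i + h_iᵀu_j)²`; if all `c_ij ≤ 0` then `H_L` is negative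
semidefinite, and if all `c_ij < 0` then `uᵀ H_L u = 0` iff `h_jᵀu_i + h_iᵀu_j = 0` for all
`i < j`. -/
theorem HL_quadratic_form (n r : ℕ) (hn : 2 ≤ n) (hr : 1 ≤ r)
    (h : Fin n → Fin (r + 1) → ℝ) (c : Fin n → Fin n → ℝ)
    (hsymm : ∀ i j, c i j = c j i) :
    (∀ u : Fin n → Fin (r + 1) → ℝ,
      (fun p : Fin n × Fin (r + 1) => u p.1 p.2) ⬝ᵥ
          (HLmat n r h c).mulVec (fun p => u p.1 p.2)
        = ∑ p ∈ Finset.univ.filter (fun p : Fin n × Fin n => p.1 < p.2),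
            c p.1 p.2 * ((∑ k, h p.2 k * u p.1 k) + ∑ k, h p.1 k * u p.2 k) ^ 2) ∧
    ((∀ i j, i ≠ j → c i j ≤ 0) →
      (HLmat n r h c).IsSymm ∧
      ∀ v : Fin n × Fin (r + 1) → ℝ, v ⬝ᵥ (HLmat n r h c).mulVec v ≤ 0) ∧
    ((∀ i j, i ≠ j → c i j < 0) →
      ∀ u : Fin n → Fin (r + 1) → ℝ,
        ((fun p : Fin n × Fin (r + 1) => u p.1 p.2) ⬝ᵥ
            (HLmat n r h c).mulVec (fun p => u p.1 p.2) = 0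
          ↔ ∀ i j : Fin n, i < j →
              (∑ k, h j k * u i k) + (∑ k, h i k * u j k) = 0)) := by
  refine ⟨HLmat_quadratic_form_eq n r h c hsymm, fun hc => ⟨HLmat_isSymm n r h c hsymm,
    fun v => ?_⟩, fun hc u => ?_⟩
  · have hv := HLmat_quadratic_form_eq n r h c hsymm fun i k => v (i, k)
    simp only [Prod.mk.eta] at hv
    rw [hv]
    exact Finset.sum_nonpos fun p hp =>
      mul_nonpos_of_nonpos_of_nonneg (hc _ _ (Finset.mem_filter.1 hp).2.ne) (sq_nonneg _)
  · rw [HLmat_quadratic_form_eq n r h c hsymm, Finset.sum_eq_zero_iff_of_nonpos fun p hp =>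
      mul_nonpos_of_nonpos_of_nonneg (hc _ _ (Finset.mem_filter.1 hp).2.ne).le (sq_nonneg _)]
    constructor
    · intro H i j hij
      have hterm := H (i, j) (Finset.mem_filter.2 ⟨Finset.mem_univ _, hij⟩)
      exact pow_eq_zero_iff two_ne_zero |>.1 ((mul_eq_zero.1 hterm).resolve_left (hc i j hij.ne).ne)
    · intro H p hp
      rw [H _ _ (Finset.mem_filter.1 hp).2]
      simp

end
end

section
/- Rotation and translation directions lie in the kernel of the leading Hessian block matrix: let n ≥ 2, r ≥ 1, z_1,…,z_n ∈ ℝ^r, h_i = (z_iᵀ, 1)ᵀ ∈ ℝ^{r+1}, and c_ij = c_ji ∈ ℝ for i ≠ j. Define H_L blockwise by [H_L]_{ii} = Σ_{j≠i} c_ij h_j h_jᵀ and [H_L]_{ij} = c_ij h_j h_iᵀ (i ≠ j). Then for every skew-symmetric matrix W ∈ ℝ^{r×r} and every v ∈ ℝ^r, the vector u ∈ ℝ^{n(r+1)} with node blocks u_i = ((W z_i + v)ᵀ, −z_iᵀ v)ᵀ satisfies H_L u = 0; indeed h_jᵀ u_i + h_iᵀ u_j = 0 for all i ≠ j. -/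
open scoped BigOperators Matrix

noncomputable section

/-- `h_i = (z_iᵀ,1)ᵀ`. -/
def hvec {r : ℕ} (z : Fin r → ℝ) : Fin (r + 1) → ℝ := Fin.snoc z 1

/-- the node block `u_i = ((W z_i + v)ᵀ, −z_iᵀv)ᵀ`. -/
def uvec {r : ℕ} (z : Fin r → ℝ) (W : Matrix (Fin r) (Fin r) ℝ) (v : Fin r → ℝ) :
    Fin (r + 1) → ℝ := Fin.snoc (W.mulVec z + v) (-(z ⬝ᵥ v))

theorem hvec_dotProduct_uvec {r : ℕ} (x y : Fin r → ℝ) (W : Matrix (Fin r) (Fin r) ℝ)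
    (v : Fin r → ℝ) : hvec x ⬝ᵥ uvec y W v = x ⬝ᵥ W *ᵥ y + x ⬝ᵥ v - y ⬝ᵥ v := by
  rw [← dotProduct_add, dotProduct, Fin.sum_univ_castSucc]
  simp [hvec, uvec, dotProduct, sub_eq_add_neg]

theorem dotProduct_mulVec_add_swap_of_transpose_eq_neg {r : ℕ} {W : Matrix (Fin r) (Fin r) ℝ}
    (hW : Wᵀ = -W) (x y : Fin r → ℝ) : x ⬝ᵥ W *ᵥ y + y ⬝ᵥ W *ᵥ x = 0 := by
  rw [Matrix.dotProduct_mulVec, ← Matrix.mulVec_transpose, hW, Matrix.neg_mulVec,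
    neg_dotProduct, dotProduct_comm, neg_add_cancel]

theorem hvec_dotProduct_uvec_add_swap {r : ℕ} {W : Matrix (Fin r) (Fin r) ℝ}
    (hW : Wᵀ = -W) (v x y : Fin r → ℝ) :
    hvec y ⬝ᵥ uvec x W v + hvec x ⬝ᵥ uvec y W v = 0 := by
  rw [hvec_dotProduct_uvec, hvec_dotProduct_uvec]
  linarith [dotProduct_mulVec_add_swap_of_transpose_eq_neg hW x y]

theorem HLmat_mulVec_apply (n r : ℕ) (h : Fin n → Fin (r + 1) → ℝ) (c : Fin n → Fin n → ℝ)
    (u : Fin n → Fin (r + 1) → ℝ) (i : Fin n) (k : Fin (r + 1)) :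
    (HLmat n r h c *ᵥ fun p => u p.1 p.2) (i, k) =
      ∑ j ∈ Finset.univ.filter (· ≠ i), c i j * h j k * (h j ⬝ᵥ u i + h i ⬝ᵥ u j) := by
  have hdiag : ∑ l, HLmat n r h c (i, k) (i, l) * u i l =
      ∑ j ∈ Finset.univ.filter (· ≠ i), c i j * h j k * (h j ⬝ᵥ u i) := by
    simp only [HLmat, Matrix.of_apply, if_true, Finset.sum_mul, dotProduct, Finset.mul_sum]
    rw [Finset.sum_comm]
    simp only [mul_assoc]
  have hoff : ∀ j ∈ Finset.univ.filter (· ≠ i), ∑ l, HLmat n r h c (i, k) (j, l) * u j l =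
      c i j * h j k * (h i ⬝ᵥ u j) := by
    intro j hj
    have hij : i ≠ j := (Finset.mem_filter.mp hj).2.symm
    simp only [HLmat, Matrix.of_apply, if_neg hij, dotProduct, Finset.mul_sum, mul_assoc]
  simp only [mul_add, Finset.sum_add_distrib]
  rw [← hdiag, ← Finset.sum_congr rfl hoff, Matrix.mulVec, dotProduct, Fintype.sum_prod_type,
    Finset.filter_ne']
  exact (Finset.add_sum_erase Finset.univ (fun j => ∑ l, HLmat n r h c (i, k) (j, l) * u j l)
    (Finset.mem_univ i)).symm

/-- **Rotation and translation directions lie in the kernel of the leading Hessian block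
matrix.** With `h_i = (z_iᵀ, 1)ᵀ`, for every skew-symmetric `W` and every `v`, the vector
`u` with node blocks `u_i = ((W z_i + v)ᵀ, −z_iᵀv)ᵀ` satisfies `H_L u = 0`; indeed
`h_jᵀ u_i + h_iᵀ u_j = 0` for all `i ≠ j`. -/
theorem rotation_translation_in_kernel (n r : ℕ) (hn : 2 ≤ n) (hr : 1 ≤ r)
    (z : Fin n → Fin r → ℝ) (c : Fin n → Fin n → ℝ)
    (hsymm : ∀ i j, c i j = c j i)
    (W : Matrix (Fin r) (Fin r) ℝ) (hW : Wᵀ = -W) (v : Fin r → ℝ) :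
    (HLmat n r (fun i => hvec (z i)) c).mulVec
        (fun p : Fin n × Fin (r + 1) => uvec (z p.1) W v p.2) = 0 ∧
    ∀ i j : Fin n, i ≠ j →
      (∑ k, hvec (z j) k * uvec (z i) W v k)
        + (∑ k, hvec (z i) k * uvec (z j) W v k) = 0 := by
  refine ⟨?_, fun i j _ => hvec_dotProduct_uvec_add_swap hW v (z i) (z j)⟩
  ext ⟨i, k⟩
  rw [HLmat_mulVec_apply n r (fun i => hvec (z i)) c (fun i => uvec (z i) W v)]
  simp [hvec_dotProduct_uvec_add_swap hW]

end
end

section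
/- Nondegeneracy of the identifiability constraints on the Hessian null directions: let n ≥ 2, r ≥ 1, and let Z ∈ ℝ^{n×r} satisfy Zᵀ1_n = 0 and ZᵀZ = D diagonal with pairwise distinct diagonal entries. Let W ∈ ℝ^{r×r} be skew-symmetric, v ∈ ℝ^r, and set U = ZWᵀ + 1_n vᵀ ∈ ℝ^{n×r}. If all off-diagonal entries of ZᵀU + UᵀZ vanish and Uᵀ1_n = 0, then W = 0 and v = 0. Equivalently, ZᵀU + UᵀZ has (k,l) entry W_{kl}(D_{ll} − D_{kk}) for k ≠ l and Uᵀ1_n = n·v, so the quadratic form Σ_{k<l} (W_{kl}(D_{ll}−D_{kk}))² + n²‖v‖² is strictly positive unless (W, v) = (0, 0). -/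
open scoped BigOperators Matrix

noncomputable section

open Matrix in
/-- A matrix with centered columns annihilates `1vᵀ` from the left after transposition. -/
theorem transpose_mul_vecMulVec_one_eq_zero {m n p R : Type*} [Fintype m] [CommRing R]
    (Z : Matrix m n R) (hZ : ∀ k, ∑ i, Z i k = 0) (v : p → R) :
    Zᵀ * vecMulVec (fun _ : m => (1 : R)) v = 0 := by
  ext k l
  simp [mul_apply, vecMulVec_apply, ← Finset.sum_mul, hZ]

open Matrix in
/-- The column sums of `ZA + 1vᵀ` are those of `1vᵀ` when the columns of `Z` are centered. -/
theorem sum_mul_add_vecMulVec_one {m n p R : Type*} [Fintype m] [Fintype n] [CommRing R]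
    (Z : Matrix m n R) (hZ : ∀ k, ∑ i, Z i k = 0) (A : Matrix n p R) (v : p → R) (k : p) :
    ∑ i, (Z * A + vecMulVec (fun _ : m => (1 : R)) v) i k = (Fintype.card m : R) * v k := by
  have h : ∑ i, (Z * A) i k = 0 := by
    simp only [mul_apply]
    rw [Finset.sum_comm]
    simp [← Finset.sum_mul, hZ]
  simp [Finset.sum_add_distrib, h, vecMulVec_apply]

open Matrix in
/-- The derivative of `ZᵀZ` along `ZWᵀ + 1vᵀ`, for `Z` centered with `ZᵀZ` diagonal and `W`
skew-symmetric. -/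
theorem gram_derivative_apply {m n R : Type*} [Fintype m] [Fintype n] [CommRing R]
    (Z : Matrix m n R) (hZ : ∀ k, ∑ i, Z i k = 0)
    (hdiag : ∀ k l : n, k ≠ l → (Zᵀ * Z) k l = 0)
    (W : Matrix n n R) (hW : Wᵀ = -W) (v : n → R) (k l : n) :
    (Zᵀ * (Z * Wᵀ + vecMulVec (fun _ : m => (1 : R)) v)
        + (Z * Wᵀ + vecMulVec (fun _ : m => (1 : R)) v)ᵀ * Z) k l
      = W k l * ((Zᵀ * Z) l l - (Zᵀ * Z) k k) := by
  have h := transpose_mul_vecMulVec_one_eq_zero Z hZ v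
  have h' : (vecMulVec (fun _ : m => (1 : R)) v)ᵀ * Z = 0 := by
    simpa [transpose_mul] using congrArg transpose h
  have hskew : W l k = -W k l := congrFun (congrFun hW k) l
  rw [transpose_add, Matrix.mul_add, Matrix.add_mul, h, h', transpose_mul, transpose_transpose,
    add_zero, add_zero, ← Matrix.mul_assoc, Matrix.mul_assoc W, Matrix.add_apply,
    mul_apply (M := Zᵀ * Z), mul_apply (M := W),
    Finset.sum_eq_single k (fun j _ hj => by rw [hdiag k j hj.symm, zero_mul]) (by simp),
    Finset.sum_eq_single l (fun j _ hj => by rw [hdiag j l hj, mul_zero]) (by simp),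
    transpose_apply, hskew]
  ring

/-- A skew-symmetric real matrix whose strictly upper-triangular entries vanish is zero. -/
theorem eq_zero_of_transpose_eq_neg_of_upper {n : Type*} [LinearOrder n]
    (W : Matrix n n ℝ) (hW : Wᵀ = -W) (h : ∀ k l, k < l → W k l = 0) : W = 0 := by
  ext k l
  have hskew : W l k = -W k l := congrFun (congrFun hW k) l
  rw [Matrix.zero_apply]
  rcases lt_trichotomy k l with hkl | rfl | hkl
  · exact h k l hkl
  · linarith
  · linarith [h l k hkl]

/-- **Nondegeneracy of the identifiability constraints on the Hessian null directions.**
Let `Zᵀ1_n = 0` and `D = ZᵀZ` be diagonal with pairwise distinct diagonal entries, `W`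
skew-symmetric, `U = ZWᵀ + 1_nvᵀ`. Then vanishing of the off-diagonal entries of
`ZᵀU + UᵀZ` together with `Uᵀ1_n = 0` forces `W = 0` and `v = 0`; equivalently,
`(ZᵀU + UᵀZ)_{kl} = W_{kl}(D_{ll} − D_{kk})` for `k ≠ l`, `Uᵀ1_n = n·v`, and the quadratic
form `Σ_{k<l}(W_{kl}(D_{ll}−D_{kk}))² + n²‖v‖²` is strictly positive unless `(W,v) = 0`. -/
theorem identifiability_penalty_nondegenerate (n r : ℕ) (hn : 2 ≤ n) (hr : 1 ≤ r)
    (Z : Matrix (Fin n) (Fin r) ℝ)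
    (hcenter : ∀ k, ∑ i, Z i k = 0)
    (hdiag : ∀ k l : Fin r, k ≠ l → (Zᵀ * Z) k l = 0)
    (hdistinct : ∀ k l : Fin r, k ≠ l → (Zᵀ * Z) k k ≠ (Zᵀ * Z) l l)
    (W : Matrix (Fin r) (Fin r) ℝ) (hW : Wᵀ = -W) (v : Fin r → ℝ) :
    (((∀ k l : Fin r, k ≠ l →
        (Zᵀ * (Z * Wᵀ + Matrix.vecMulVec (fun _ : Fin n => (1 : ℝ)) v)
          + (Z * Wᵀ + Matrix.vecMulVec (fun _ : Fin n => (1 : ℝ)) v)ᵀ * Z) k l = 0) ∧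
      (∀ k, ∑ i, (Z * Wᵀ + Matrix.vecMulVec (fun _ : Fin n => (1 : ℝ)) v) i k = 0)) →
      W = 0 ∧ v = 0) ∧
    (∀ k l : Fin r, k ≠ l →
      (Zᵀ * (Z * Wᵀ + Matrix.vecMulVec (fun _ : Fin n => (1 : ℝ)) v)
        + (Z * Wᵀ + Matrix.vecMulVec (fun _ : Fin n => (1 : ℝ)) v)ᵀ * Z) k l
        = W k l * ((Zᵀ * Z) l l - (Zᵀ * Z) k k)) ∧
    (∀ k, ∑ i, (Z * Wᵀ + Matrix.vecMulVec (fun _ : Fin n => (1 : ℝ)) v) i k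
        = (n : ℝ) * v k) ∧
    (¬(W = 0 ∧ v = 0) →
      0 < (∑ p ∈ Finset.univ.filter (fun p : Fin r × Fin r => p.1 < p.2),
            (W p.1 p.2 * ((Zᵀ * Z) p.2 p.2 - (Zᵀ * Z) p.1 p.1)) ^ 2)
          + (n : ℝ) ^ 2 * ∑ k, (v k) ^ 2) := by
  have hn0 : (n : ℝ) ≠ 0 := by exact_mod_cast (by omega : n ≠ 0)
  have hgram := gram_derivative_apply Z hcenter hdiag W hW v
  have hsum : ∀ k, ∑ i, (Z * Wᵀ + Matrix.vecMulVec (fun _ : Fin n => (1 : ℝ)) v) i k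
      = (n : ℝ) * v k := by
    simpa using sum_mul_add_vecMulVec_one Z hcenter Wᵀ v
  have hzero : (∀ k l : Fin r, k < l → W k l * ((Zᵀ * Z) l l - (Zᵀ * Z) k k) = 0) → W = 0 :=
    fun h => eq_zero_of_transpose_eq_neg_of_upper W hW fun k l hkl =>
      (mul_eq_zero.mp (h k l hkl)).resolve_right (sub_ne_zero.mpr (hdistinct l k hkl.ne'))
  refine ⟨fun ⟨hoff, hcol⟩ => ⟨hzero fun k l hkl => ?_, funext fun k => ?_⟩,
    fun k l _ => hgram k l, hsum, fun hne => ?_⟩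
  · rw [← hgram, hoff k l hkl.ne]
  · exact (mul_eq_zero.mp ((hsum k).symm.trans (hcol k))).resolve_left hn0
  · have hA : 0 ≤ ∑ p ∈ Finset.univ.filter (fun p : Fin r × Fin r => p.1 < p.2),
        (W p.1 p.2 * ((Zᵀ * Z) p.2 p.2 - (Zᵀ * Z) p.1 p.1)) ^ 2 :=
      Finset.sum_nonneg fun _ _ => sq_nonneg _
    have hB : 0 ≤ ∑ k, (v k) ^ 2 := Finset.sum_nonneg fun _ _ => sq_nonneg _
    have hB' : 0 ≤ (n : ℝ) ^ 2 * ∑ k, (v k) ^ 2 := mul_nonneg (sq_nonneg _) hB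
    refine (add_nonneg hA hB').lt_of_ne fun h => hne ?_
    obtain ⟨hA0, hB0⟩ := (add_eq_zero_iff_of_nonneg hA hB').mp h.symm
    constructor
    · rw [Finset.sum_eq_zero_iff_of_nonneg fun _ _ => sq_nonneg _] at hA0
      exact hzero fun k l hkl => pow_eq_zero_iff two_ne_zero |>.mp (hA0 (k, l) (by simpa using hkl))
    · have hv := (mul_eq_zero.mp hB0).resolve_left (pow_ne_zero 2 hn0)
      rw [Finset.sum_eq_zero_iff_of_nonneg fun _ _ => sq_nonneg _] at hv
      exact funext fun k => pow_eq_zero_iff two_ne_zero |>.mp (hv k (Finset.mem_univ k))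

end
end

section
/- Existence of identifiable reparametrization: for every Z ∈ ℝ^{n×r} and α ∈ ℝ^n there exist Z̃ ∈ ℝ^{n×r} and α̃ ∈ ℝ^n such that Z̃ᵀ1_n = 0, Z̃ᵀZ̃ is a diagonal matrix, and Z̃Z̃ᵀ + α̃1_nᵀ + 1_nα̃ᵀ = ZZᵀ + α1_nᵀ + 1_nαᵀ. (Concretely, one may take Z̃ = (I_n − 1_n1_nᵀ/n) Z O for a suitable orthogonal matrix O ∈ ℝ^{r×r}, and α̃ = α + Z̃ z̄ + (‖z̄‖²/2)1_n with z̄ = Zᵀ1_n/n, where z̄ is expressed in the rotated coordinates.) -/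
open scoped BigOperators Matrix

noncomputable section

/-- Every real matrix can be rotated on the right so that its columns become orthogonal. -/
theorem exists_orthogonal_isDiag_gram {m k : Type*} [Fintype m] [Fintype k] [DecidableEq k]
    (B : Matrix m k ℝ) :
    ∃ O : Matrix k k ℝ, O * Oᵀ = 1 ∧ ((B * O)ᵀ * (B * O)).IsDiag := by
  have hA : (Bᵀ * B).IsHermitian := by
    simpa [Matrix.conjTranspose_eq_transpose_of_trivial] using
      Matrix.isHermitian_conjTranspose_mul_self B
  refine ⟨hA.eigenvectorUnitary, ?_, ?_⟩
  · simpa [Matrix.star_eq_conjTranspose, Matrix.conjTranspose_eq_transpose_of_trivial] using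
      Unitary.coe_mul_star_self hA.eigenvectorUnitary
  · have h := hA.conjStarAlgAut_star_eigenvectorUnitary
    rw [Unitary.conjStarAlgAut_star_apply, Matrix.star_eq_conjTranspose,
      Matrix.conjTranspose_eq_transpose_of_trivial] at h
    rw [Matrix.transpose_mul, Matrix.mul_assoc, ← Matrix.mul_assoc Bᵀ, ← Matrix.mul_assoc, h]
    exact Matrix.isDiag_diagonal _

/-- Centering the latent positions can be absorbed into the degree parameters. -/
theorem exists_centered_reparametrization {m k : Type*} [Fintype m] [Fintype k]
    (Z : Matrix m k ℝ) (α : m → ℝ) :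
    ∃ (Y : Matrix m k ℝ) (β : m → ℝ), (∀ l, ∑ i, Y i l = 0) ∧
      ∀ i j, (Y * Yᵀ) i j + β i + β j = (Z * Zᵀ) i j + α i + α j := by
  let c : k → ℝ := fun l => (∑ i, Z i l) / Fintype.card m
  refine ⟨Matrix.of fun i l => Z i l - c l,
    fun i => α i + ∑ l, ((Z i l - c l) * c l + c l ^ 2 / 2), fun l => ?_, fun i j => ?_⟩
  · rcases isEmpty_or_nonempty m with _ | _
    · simp
    · have : (Fintype.card m : ℝ) ≠ 0 := by simp
      simp only [Matrix.of_apply, Finset.sum_sub_distrib, Finset.sum_const, Finset.card_univ,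
        nsmul_eq_mul, c]
      field_simp
      ring
  · have h : ∑ l, (Z i l - c l) * (Z j l - c l) + ∑ l, ((Z i l - c l) * c l + c l ^ 2 / 2) +
        ∑ l, ((Z j l - c l) * c l + c l ^ 2 / 2) = ∑ l, Z i l * Z j l := by
      rw [← Finset.sum_add_distrib, ← Finset.sum_add_distrib]
      exact Finset.sum_congr rfl fun l _ => by ring
    simp only [Matrix.mul_apply, Matrix.transpose_apply, Matrix.of_apply]
    linarith

/-- **Existence of an identifiable reparametrization.** For every `Z ∈ ℝ^{n×r}` and
`α ∈ ℝ^n` there exist `Z̃` and `α̃` with `Z̃ᵀ1_n = 0`, `Z̃ᵀZ̃` diagonal, and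
`Z̃Z̃ᵀ + α̃1_nᵀ + 1_nα̃ᵀ = ZZᵀ + α1_nᵀ + 1_nαᵀ`. -/
theorem exists_identifiable_reparametrization (n r : ℕ)
    (Z : Matrix (Fin n) (Fin r) ℝ) (α : Fin n → ℝ) :
    ∃ (Zt : Matrix (Fin n) (Fin r) ℝ) (αt : Fin n → ℝ),
      (∀ k, ∑ i, Zt i k = 0) ∧
      (∀ k l : Fin r, k ≠ l → (Ztᵀ * Zt) k l = 0) ∧
      (∀ i j : Fin n, (Zt * Ztᵀ) i j + αt i + αt j = (Z * Zᵀ) i j + α i + α j) := by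
  obtain ⟨Y, β, hY, hβ⟩ := exists_centered_reparametrization Z α
  obtain ⟨O, hO, hdiag⟩ := exists_orthogonal_isDiag_gram Y
  refine ⟨Y * O, β, fun k => ?_, fun k l hkl => hdiag hkl, fun i j => ?_⟩
  · simp only [Matrix.mul_apply]
    rw [Finset.sum_comm]
    simp [← Finset.sum_mul, hY]
  · rw [Matrix.transpose_mul, Matrix.mul_assoc, ← Matrix.mul_assoc O, hO, Matrix.one_mul]
    exact hβ i j

end
end

section
/- Identifiability of the latent space model parameters under centering: let Z_1, Z_2 ∈ ℝ^{n×r} with Z_1ᵀ1_n = 0 and Z_2ᵀ1_n = 0, and let α_1, α_2 ∈ ℝ^n. If Z_1Z_1ᵀ + α_11_nᵀ + 1_nα_1ᵀ = Z_2Z_2ᵀ + α_21_nᵀ + 1_nα_2ᵀ, then α_1 = α_2, Z_1Z_1ᵀ = Z_2Z_2ᵀ, and there exists an orthogonal matrix O ∈ ℝ^{r×r} with Z_2 = Z_1 O. Moreover α is recovered explicitly from Π = ZZᵀ + α1_nᵀ + 1_nαᵀ by α = Π1_n/n − (1_nᵀΠ1_n/(2n²))·1_n whenever Zᵀ1_n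 = 0. -/
open scoped BigOperators Matrix

noncomputable section

open scoped InnerProductSpace

/-- Linear maps into a finite-dimensional inner product space with pointwise equal norms differ by
a linear isometry of the target. -/
theorem LinearMap.exists_linearIsometry_apply_eq_of_norm_eq {𝕜 W V : Type*} [RCLike 𝕜]
    [AddCommGroup W] [Module 𝕜 W] [NormedAddCommGroup V] [InnerProductSpace 𝕜 V]
    [FiniteDimensional 𝕜 V] (f g : W →ₗ[𝕜] V) (h : ∀ x, ‖f x‖ = ‖g x‖) :
    ∃ L : V →ₗᵢ[𝕜] V, ∀ x, L (f x) = g x := by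
  obtain ⟨s, hs⟩ := f.rangeRestrict.exists_rightInverse_of_surjective f.range_rangeRestrict
  have hfs (y : LinearMap.range f) : f (s y) = y :=
    congrArg Subtype.val (LinearMap.congr_fun hs y)
  let L₀ : LinearMap.range f →ₗᵢ[𝕜] V :=
    { toLinearMap := g ∘ₗ s
      norm_map' := fun y => by
        rw [LinearMap.comp_apply, ← h, hfs, Submodule.coe_norm] }
  refine ⟨L₀.extend, fun x => ?_⟩
  have hx : L₀.extend (f x) = g (s (f.rangeRestrict x)) := L₀.extend_apply (f.rangeRestrict x)
  rw [hx, ← sub_eq_zero, ← map_sub, ← norm_eq_zero, ← h, map_sub, hfs, LinearMap.codRestrict_apply,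
    sub_self, norm_zero]

/-- Two finite families of vectors with the same Gram matrix differ by a linear isometry. -/
theorem exists_linearIsometry_apply_eq_of_inner_eq {ι V : Type*} [Fintype ι]
    [NormedAddCommGroup V] [InnerProductSpace ℝ V] [FiniteDimensional ℝ V] (v w : ι → V)
    (h : ∀ i j, ⟪v i, v j⟫_ℝ = ⟪w i, w j⟫_ℝ) :
    ∃ L : V →ₗᵢ[ℝ] V, ∀ i, L (v i) = w i := by
  classical
  obtain ⟨L, hL⟩ := LinearMap.exists_linearIsometry_apply_eq_of_norm_eq
    (Fintype.linearCombination ℝ v) (Fintype.linearCombination ℝ w) fun c => by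
      rw [← sq_eq_sq₀ (norm_nonneg _) (norm_nonneg _), ← real_inner_self_eq_norm_sq,
        ← real_inner_self_eq_norm_sq]
      simp only [Fintype.linearCombination_apply, sum_inner, inner_sum, real_inner_smul_left,
        real_inner_smul_right, h]
  refine ⟨L, fun i => ?_⟩
  simpa [Fintype.linearCombination_apply_single] using hL (Pi.single i 1)

/-- Real matrices with `A * Aᵀ = B * Bᵀ` differ by an orthogonal matrix on the right. -/
theorem Matrix.exists_orthogonal_eq_mul_of_mul_transpose_eq {m n : Type*} [Fintype m] [Fintype n]
    [DecidableEq n] (A B : Matrix m n ℝ) (h : A * Aᵀ = B * Bᵀ) :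
    ∃ O ∈ Matrix.orthogonalGroup n ℝ, B = A * O := by
  have inner_row (C : Matrix m n ℝ) (i j : m) :
      ⟪WithLp.toLp 2 (C i), WithLp.toLp 2 (C j)⟫_ℝ = (C * Cᵀ) i j := by
    simp [PiLp.inner_apply, Matrix.mul_apply, mul_comm]
  obtain ⟨L, hL⟩ := exists_linearIsometry_apply_eq_of_inner_eq
    (fun i => WithLp.toLp 2 (A i)) (fun i => WithLp.toLp 2 (B i))
    fun i j => by rw [inner_row, inner_row, h]
  refine ⟨Matrix.of fun k l => L (EuclideanSpace.single k 1) l, ?_, ?_⟩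
  · rw [Matrix.mem_orthogonalGroup_iff]
    ext k l
    have hkl := L.inner_map_map (EuclideanSpace.single k (1 : ℝ)) (EuclideanSpace.single l 1)
    rw [PiLp.inner_apply] at hkl
    simpa [Matrix.mul_apply, Matrix.one_apply, mul_comm, EuclideanSpace.inner_single_left, eq_comm]
      using hkl
  · ext i l
    have hrow : WithLp.toLp 2 (A i) = ∑ k, A i k • EuclideanSpace.single k (1 : ℝ) := by
      ext l
      simp [Pi.single_apply]
    have hil := congrArg (fun x : EuclideanSpace ℝ n => x l) (hL i)
    simp only [hrow, map_sum, map_smul] at hil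
    simpa [Matrix.mul_apply] using hil.symm

/-- The rows of `A * Aᵀ` sum to zero when the columns of `A` do. -/
theorem Matrix.sum_mul_transpose_self_eq_zero {m n : Type*} [Fintype m] [Fintype n]
    (A : Matrix m n ℝ) (hA : ∀ k, ∑ i, A i k = 0) (i : m) : ∑ j, (A * Aᵀ) i j = 0 := by
  simp only [Matrix.mul_apply, Matrix.transpose_apply]
  rw [Finset.sum_comm]
  simp [← Finset.mul_sum, hA]

/-- The node heterogeneity parameters are recovered from the row sums and the total sum of the
edge parameters of a centered latent space model. -/
theorem heterogeneity_eq_of_centered {n r : ℕ} (hn : 0 < n) (Z : Matrix (Fin n) (Fin r) ℝ)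
    (α : Fin n → ℝ) (hZ : ∀ k, ∑ i, Z i k = 0) (i : Fin n) :
    α i = (∑ j, ((Z * Zᵀ) i j + α i + α j)) / n
      - (∑ i', ∑ j, ((Z * Zᵀ) i' j + α i' + α j)) / (2 * (n : ℝ) ^ 2) := by
  have hn' : (n : ℝ) ≠ 0 := by positivity
  simp only [Finset.sum_add_distrib, Matrix.sum_mul_transpose_self_eq_zero Z hZ, Finset.sum_const,
    Finset.card_univ, Fintype.card_fin, nsmul_eq_mul, ← Finset.mul_sum]
  field_simp
  ring

/-- **Identifiability of the latent space model parameters under centering.** If `Z₁, Z₂`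
are centered and `Z₁Z₁ᵀ + α₁1ᵀ + 1α₁ᵀ = Z₂Z₂ᵀ + α₂1ᵀ + 1α₂ᵀ`, then `α₁ = α₂`,
`Z₁Z₁ᵀ = Z₂Z₂ᵀ`, and `Z₂ = Z₁O` for some orthogonal `O`. Moreover `α` is recovered from
`Π = ZZᵀ + α1ᵀ + 1αᵀ` by `α = Π1/n − (1ᵀΠ1/(2n²))·1` whenever `Zᵀ1 = 0`. -/
theorem latent_space_identifiability (n r : ℕ) (hn : 0 < n)
    (Z₁ Z₂ : Matrix (Fin n) (Fin r) ℝ) (α₁ α₂ : Fin n → ℝ)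
    (hc₁ : ∀ k, ∑ i, Z₁ i k = 0) (hc₂ : ∀ k, ∑ i, Z₂ i k = 0)
    (heq : ∀ i j : Fin n,
      (Z₁ * Z₁ᵀ) i j + α₁ i + α₁ j = (Z₂ * Z₂ᵀ) i j + α₂ i + α₂ j) :
    α₁ = α₂ ∧
    Z₁ * Z₁ᵀ = Z₂ * Z₂ᵀ ∧
    (∃ O ∈ Matrix.orthogonalGroup (Fin r) ℝ, Z₂ = Z₁ * O) ∧
    (∀ (Z : Matrix (Fin n) (Fin r) ℝ) (α : Fin n → ℝ), (∀ k, ∑ i, Z i k = 0) →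
      ∀ i, α i = (∑ j, ((Z * Zᵀ) i j + α i + α j)) / n
        - (∑ i', ∑ j, ((Z * Zᵀ) i' j + α i' + α j)) / (2 * (n : ℝ) ^ 2)) := by
  have hα : α₁ = α₂ := by
    ext i
    rw [heterogeneity_eq_of_centered hn Z₁ α₁ hc₁ i, heterogeneity_eq_of_centered hn Z₂ α₂ hc₂ i]
    simp only [heq]
  have hZ : Z₁ * Z₁ᵀ = Z₂ * Z₂ᵀ := by
    ext i j
    simpa [hα] using heq i j
  exact ⟨hα, hZ, Matrix.exists_orthogonal_eq_mul_of_mul_transpose_eq Z₁ Z₂ hZ,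
    fun Z α hc i => heterogeneity_eq_of_centered hn Z α hc i⟩


end
end
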